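/- arXiv:2111.09606 — 2 statements merged into one kernel-verified Lean document; each statement's English description precedes it below -/
import Mathlib

section
/- Let p ≥ 2, d ≥ 1, n_1, …, n_p ≥ 1, and let e_k, f_k, g_{k,i}, h_{k,i} ∈ ℝ^{n_k} be given for k = 1, …, p and i = 1, …, d. Define the order-p tensor T = Σ_{k=1}^p (e_1 ⊗ ⋯ ⊗ f_k ⊗ ⋯ ⊗ e_p) + Σ_{k_1=1}^{p-1} Σ_{k_2=k_1+1}^{p} Σ_{i=1}^{d} (e_1 ⊗ ⋯ ⊗ g_{k_1,i} ⊗ ⋯ ⊗ h_{k_2,i} ⊗ ⋯ ⊗ e_p) + Σ_{k_1=1}^{p-1} Σ_{k_2=k_1+1}^{p} Σ_{i=1}^{d} (e_1 ⊗ ⋯ ⊗ h_{k_1,i} ⊗ ⋯ ⊗ g_{k_2,i} ⊗ ⋯ ⊗ e_p), where in each summand the displayed vectors occupy the indicated factor positions and all other factors are the vectors e_j. Then T admits a tensor train representation with all interior ranks equal to 2d+2 and cores: T^{(1)} ∈ ℝ^{1×n_1×(2d+2)} with T^{(1)}_{1,:,1} = e_1, T^{(1)}_{1,:,2} = f_1,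 T^{(1)}_{1,:,2+i} = g_{1,i}, T^{(1)}_{1,:,2+d+i} = h_{1,i}; for k = 2, …, p−1, T^{(k)} ∈ ℝ^{(2d+2)×n_k×(2d+2)} with first-row entries T^{(k)}_{1,:,1} = e_k, T^{(k)}_{1,:,2} = f_k, T^{(k)}_{1,:,2+i} = g_{k,i}, T^{(k)}_{1,:,2+d+i} = h_{k,i}, second-column entries T^{(k)}_{2,:,2} = e_k, T^{(k)}_{2+i,:,2} = h_{k,i}, T^{(k)}_{2+d+i,:,2} = g_{k,i}, diagonal entries T^{(k)}_{j,:,j} = e_k for j = 3, …, 2d+2, and all other entries zero; and T^{(p)} ∈ ℝ^{(2d+2)×n_p×1} with T^{(p)}_{1,:,1} = f_p, T^{(p)}_{2,:,1} = e_p, T^{(p)}_{2+i,:,1} = h_{p,i}, T^{(p)}_{2+d+i,:,1} = g_{p,i}. -/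
open Finset

/-- Entries of the order-`p` tensor `T` of Corollary 1 (symmetrized version):
`T = Σ_k e₁ ⊗ ⋯ ⊗ f_k ⊗ ⋯ ⊗ e_p
   + Σ_{k₁<k₂} Σ_i e₁ ⊗ ⋯ ⊗ g_{k₁,i} ⊗ ⋯ ⊗ h_{k₂,i} ⊗ ⋯ ⊗ e_p
   + Σ_{k₁<k₂} Σ_i e₁ ⊗ ⋯ ⊗ h_{k₁,i} ⊗ ⋯ ⊗ g_{k₂,i} ⊗ ⋯ ⊗ e_p`.
Indices are zero-based. -/
def symStructTensor (p d : ℕ) (n : Fin p → ℕ)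
    (e f : (k : Fin p) → Fin (n k) → ℝ)
    (g h : (k : Fin p) → Fin d → Fin (n k) → ℝ)
    (u : (k : Fin p) → Fin (n k)) : ℝ :=
  (∑ k : Fin p, ∏ j : Fin p, if j = k then f j (u j) else e j (u j)) +
    (∑ k₁ : Fin p, ∑ k₂ : Fin p, ∑ i : Fin d,
      if k₁ < k₂ then
        ∏ j : Fin p,
          if j = k₁ then g j i (u j)
          else if j = k₂ then h j i (u j)
          else e j (u j)
      else 0) +
    ∑ k₁ : Fin p, ∑ k₂ : Fin p, ∑ i : Fin d,
      if k₁ < k₂ then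
        ∏ j : Fin p,
          if j = k₁ then h j i (u j)
          else if j = k₂ then g j i (u j)
          else e j (u j)
      else 0

/-- The TT core of rank `2d + 2` from Corollary 1 (zero-based indices):
row `0` is `(e_k, f_k, g_{k,1}, …, g_{k,d}, h_{k,1}, …, h_{k,d})`, column `1` is
`(f_k, e_k, h_{k,1}, …, h_{k,d}, g_{k,1}, …, g_{k,d})`, the diagonal entries
`(j, j)` for `j ≥ 2` are `e_k`, and all other entries vanish.  The first core
of the tensor train is row `0` of this core, the last core is column `1`. -/
def symCore (p d : ℕ) (n : Fin p → ℕ)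
    (e f : (k : Fin p) → Fin (n k) → ℝ)
    (g h : (k : Fin p) → Fin d → Fin (n k) → ℝ)
    (k : Fin p) (s : Fin (2 * d + 2)) (u : Fin (n k)) (t : Fin (2 * d + 2)) : ℝ :=
  if s.val = 0 then
    if t.val = 0 then e k u
    else if t.val = 1 then f k u
    else if ht : t.val - 2 < d then g k ⟨t.val - 2, ht⟩ u
    else if ht' : t.val - 2 - d < d then h k ⟨t.val - 2 - d, ht'⟩ u
    else 0
  else if s.val = 1 then
    if t.val = 1 then e k u else 0
  else
    if t.val = 1 then
      if hs : s.val - 2 < d then h k ⟨s.val - 2, hs⟩ u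
      else if hs' : s.val - 2 - d < d then g k ⟨s.val - 2 - d, hs'⟩ u
      else 0
    else if t = s then e k u else 0

/-- Left rank index of core `k` (boundary `s₀ = 0`, i.e. first core = row `0`). -/
def symLeft (p d : ℕ) (s : Fin (p - 1) → Fin (2 * d + 2)) (k : Fin p) :
    Fin (2 * d + 2) :=
  if hk : k.val = 0 then ⟨0, by omega⟩
  else s ⟨k.val - 1, by have := k.isLt; omega⟩

/-- Right rank index of core `k` (boundary `s_p = 1`, i.e. last core = column `1`). -/
def symRight (p d : ℕ) (s : Fin (p - 1) → Fin (2 * d + 2)) (k : Fin p) :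
    Fin (2 * d + 2) :=
  if hk : k.val < p - 1 then s ⟨k.val, hk⟩ else ⟨1, by omega⟩

/-- Scalar version of the core. -/
def coreS (d : ℕ) (e f : ℝ) (g h : Fin d → ℝ) (s t : Fin (2 * d + 2)) : ℝ :=
  if s.val = 0 then
    if t.val = 0 then e
    else if t.val = 1 then f
    else if ht : t.val - 2 < d then g ⟨t.val - 2, ht⟩
    else if ht' : t.val - 2 - d < d then h ⟨t.val - 2 - d, ht'⟩
    else 0
  else if s.val = 1 then
    if t.val = 1 then e else 0
  else
    if t.val = 1 then
      if hs : s.val - 2 < d then h ⟨s.val - 2, hs⟩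
      else if hs' : s.val - 2 - d < d then g ⟨s.val - 2 - d, hs'⟩
      else 0
    else if t = s then e else 0

/-- Sum over paths with prescribed endpoints. -/
def pathSum {R : Type} [Fintype R] (m : ℕ) (M : Fin (m + 1) → R → R → ℝ) (a b : R) : ℝ :=
  ∑ s : Fin m → R, ∏ k : Fin (m + 1),
    M k ((Fin.cons a s : Fin (m + 1) → R) k) ((Fin.snoc s b : Fin (m + 1) → R) k)

lemma pathSum_zero {R : Type} [Fintype R] (M : Fin 1 → R → R → ℝ) (a b : R) :
    pathSum 0 M a b = M 0 a b := by
  simp [pathSum, Fin.snoc]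

lemma pathSum_succ {R : Type} [Fintype R] (m : ℕ) (M : Fin (m + 2) → R → R → ℝ) (a b : R) :
    pathSum (m + 1) M a b = ∑ t, M 0 a t * pathSum m (fun k => M k.succ) t b := by
  unfold pathSum
  rw [← (Fin.consEquiv (fun _ : Fin (m + 1) => R)).sum_comp, Fintype.sum_prod_type]
  refine Finset.sum_congr rfl fun t _ => ?_
  rw [Finset.mul_sum]
  refine Finset.sum_congr rfl fun s _ => ?_
  rw [Fin.prod_univ_succ]
  have hs : (Fin.snoc (Fin.cons t s : Fin (m + 1) → R) b : Fin (m + 2) → R)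
      = Fin.cons t (Fin.snoc s b : Fin (m + 1) → R) :=
    (Fin.cons_snoc_eq_snoc_cons t s b).symm
  change M 0 a ((Fin.snoc (Fin.cons t s : Fin (m + 1) → R) b : Fin (m + 2) → R) 0) *
    ∏ x : Fin (m + 1), M x.succ ((Fin.cons t s : Fin (m + 1) → R) x)
      ((Fin.snoc (Fin.cons t s : Fin (m + 1) → R) b : Fin (m + 2) → R) x.succ) = _
  rw [hs]
  simp only [Fin.cons_zero, Fin.cons_succ]

/-- Rank index `2 + i`. -/
def idxA {d : ℕ} (i : Fin d) : Fin (2 * d + 2) := ⟨i.val + 2, by omega⟩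
/-- Rank index `2 + d + i`. -/
def idxB {d : ℕ} (i : Fin d) : Fin (2 * d + 2) := ⟨d + i.val + 2, by omega⟩

lemma sum_idx (d : ℕ) (F : Fin (2 * d + 2) → ℝ) :
    ∑ t, F t = F ⟨0, by omega⟩ + F ⟨1, by omega⟩ + ∑ i : Fin d, F (idxA i)
      + ∑ i : Fin d, F (idxB i) := by
  rw [Fin.sum_univ_succ, Fin.sum_univ_succ,
    ← (finCongr (two_mul d).symm).sum_comp, Fin.sum_univ_add, ← add_assoc, ← add_assoc]
  rfl

/-- One-site sum. -/
def oneS (m : ℕ) (E A : Fin m → ℝ) : ℝ := ∑ k : Fin m, ∏ j : Fin m, if j = k then A j else E j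

/-- Two-site sum. -/
def twoS (m d : ℕ) (E : Fin m → ℝ) (G H : Fin m → Fin d → ℝ) : ℝ :=
  ∑ k₁ : Fin m, ∑ k₂ : Fin m, ∑ i : Fin d,
      if k₁ < k₂ then
        ∏ j : Fin m, if j = k₁ then G j i else if j = k₂ then H j i else E j
      else 0

lemma oneS_succ (m : ℕ) (E A : Fin (m + 1) → ℝ) :
    oneS (m + 1) E A = A 0 * ∏ j : Fin m, E j.succ
      + E 0 * oneS m (fun j => E j.succ) (fun j => A j.succ) := by
  unfold oneS
  rw [Fin.sum_univ_succ, Finset.mul_sum]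
  congr 1
  · simp [Fin.prod_univ_succ, Fin.succ_ne_zero]
  · refine Finset.sum_congr rfl fun k _ => ?_
    simp [Fin.prod_univ_succ, (Fin.succ_ne_zero k).symm]

lemma twoS_succ (m d : ℕ) (E : Fin (m + 1) → ℝ) (G H : Fin (m + 1) → Fin d → ℝ) :
    twoS (m + 1) d E G H =
      ∑ i, G 0 i * oneS m (fun j => E j.succ) (fun j => H j.succ i)
      + E 0 * twoS m d (fun j => E j.succ) (fun j => G j.succ) (fun j => H j.succ) := by
  unfold twoS oneS
  rw [Fin.sum_univ_succ]
  congr 1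
  · rw [Fin.sum_univ_succ]
    simp only [lt_irrefl, if_false, Finset.sum_const_zero, zero_add, Fin.succ_pos, if_true]
    rw [Finset.sum_comm]
    refine Finset.sum_congr rfl fun i _ => ?_
    rw [Finset.mul_sum]
    refine Finset.sum_congr rfl fun k _ => ?_
    simp [Fin.prod_univ_succ, Fin.succ_ne_zero]
  · rw [Finset.mul_sum]
    refine Finset.sum_congr rfl fun k _ => ?_
    rw [Fin.sum_univ_succ, Finset.mul_sum]
    simp only [Fin.not_lt_zero, if_false, Finset.sum_const_zero, zero_add]
    refine Finset.sum_congr rfl fun l _ => ?_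
    rw [Finset.mul_sum]
    refine Finset.sum_congr rfl fun i _ => ?_
    simp [Fin.prod_univ_succ, (Fin.succ_ne_zero _).symm]

lemma path_closed (d m : ℕ) (E F : Fin (m + 1) → ℝ) (G H : Fin (m + 1) → Fin d → ℝ) :
    pathSum m (fun k => coreS d (E k) (F k) (G k) (H k)) ⟨1, by omega⟩ ⟨1, by omega⟩
      = ∏ j, E j ∧
    (∀ i, pathSum m (fun k => coreS d (E k) (F k) (G k) (H k)) (idxA i) ⟨1, by omega⟩
      = oneS (m + 1) E (fun j => H j i)) ∧
    (∀ i, pathSum m (fun k => coreS d (E k) (F k) (G k) (H k)) (idxB i) ⟨1, by omega⟩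
      = oneS (m + 1) E (fun j => G j i)) ∧
    pathSum m (fun k => coreS d (E k) (F k) (G k) (H k)) ⟨0, by omega⟩ ⟨1, by omega⟩
      = oneS (m + 1) E F + twoS (m + 1) d E G H + twoS (m + 1) d E H G := by
  induction m with
  | zero =>
    simp only [pathSum_zero, oneS_succ, twoS_succ]
    refine ⟨?_, fun i => ?_, fun i => ?_, ?_⟩ <;> simp [coreS, oneS, twoS, idxA, idxB]
  | succ m ih =>
    obtain ⟨h1, hA, hB, h0⟩ := ih (fun j => E j.succ) (fun j => F j.succ)
      (fun j => G j.succ) (fun j => H j.succ)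
    simp only [pathSum_succ, sum_idx, h1, hA, hB, h0]
    refine ⟨?_, fun i => ?_, fun i => ?_, ?_⟩
    · rw [Fin.prod_univ_succ E]
      simp [coreS, idxA, idxB]
    · rw [oneS_succ _ E]
      have hne : ∀ x : Fin d, ¬ (d + x.val = i.val) := fun x => by omega
      simp [coreS, idxA, idxB, hne, Fin.val_inj]
    · rw [oneS_succ _ E]
      have hne : ∀ x : Fin d, ¬ (x.val = d + i.val) := fun x => by omega
      simp [coreS, idxA, idxB, hne, Fin.val_inj]
    · rw [oneS_succ _ E, twoS_succ _ _ E G, twoS_succ _ _ E H]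
      simp [coreS, idxA, idxB]
      ring

/-- **Corollary 1**: the symmetrized structured sum of rank-one tensors admits a
tensor train representation with all interior ranks equal to `2d + 2` and the
cores given by `symCore` (first core = row `0`, last core = column `1`). -/
theorem symmetric_tt_representation (p d : ℕ) (hp : 2 ≤ p) (hd : 1 ≤ d)
    (n : Fin p → ℕ) (hn : ∀ k, 1 ≤ n k)
    (e f : (k : Fin p) → Fin (n k) → ℝ)
    (g h : (k : Fin p) → Fin d → Fin (n k) → ℝ)
    (u : (k : Fin p) → Fin (n k)) :
    symStructTensor p d n e f g h u =
      ∑ s : Fin (p - 1) → Fin (2 * d + 2),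
        ∏ k : Fin p,
          symCore p d n e f g h k (symLeft p d s k) (u k) (symRight p d s k) := by
  obtain ⟨m, rfl⟩ : ∃ m, p = m + 1 := ⟨p - 1, by omega⟩
  have key := (path_closed d m (fun k => e k (u k)) (fun k => f k (u k))
    (fun k i => g k i (u k)) (fun k i => h k i (u k))).2.2.2
  refine Eq.trans key.symm ?_
  unfold pathSum
  refine Finset.sum_congr rfl fun s _ => Finset.prod_congr rfl fun k _ => ?_
  have hL : (Fin.cons ⟨0, by omega⟩ s : Fin (m + 1) → Fin (2 * d + 2)) k
      = symLeft (m + 1) d s k := by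
    refine Fin.cases ?_ (fun j => ?_) k
    · simp [symLeft]
    · simp [symLeft]
  have hR : (Fin.snoc s ⟨1, by omega⟩ : Fin (m + 1) → Fin (2 * d + 2)) k
      = symRight (m + 1) d s k := by
    rfl
  rw [← hL, ← hR]
  rfl
end

section
/- Let p ≥ 2, d ≥ 1, n_1, …, n_p ≥ 1. Let b : ℝ^d → ℝ^d and σ : ℝ^d → ℝ^{d×d} be given, set a(x) = σ(x)σ(x)^T, and define the Kolmogorov backward operator L acting on twice continuously differentiable scalar functions φ by Lφ(x) = ½ Σ_{i,j=1}^d a_{ij}(x) ∂²φ/∂x^i∂x^j(x) + Σ_{i=1}^d b_i(x) ∂φ/∂x^i(x). For k = 1, …, p let ψ_k : ℝ^d → ℝ^{n_k} be twice continuously differentiable, and fix x ∈ ℝ^d. Define LΨ(x) ∈ ℝ^{n_1×⋯×n_p} entrywise by LΨ(x)_{u_1,…,u_p} = L(ψ_{1,u_1} ⋯ ψ_{p,u_p})(x). Then LΨ(x) admits a tensor train representation with all interior ranks equal to d+2 and cores: core 1 ∈ ℝ^{1×n_1×(d+2)} with entries (1,:,1) = ψ_1(x), (1,:,2) = Lψ_1(x),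 (1,:,2+i) = ∇ψ_1(x)·σ_{:,i}(x) for i = 1, …, d; for k = 2, …, p−1, core k ∈ ℝ^{(d+2)×n_k×(d+2)} with entries (1,:,1) = ψ_k(x), (1,:,2) = Lψ_k(x), (1,:,2+i) = ∇ψ_k(x)·σ_{:,i}(x), (2,:,2) = ψ_k(x), (2+i,:,2) = ∇ψ_k(x)·σ_{:,i}(x), (2+i,:,2+i) = ψ_k(x), and all other entries zero; and core p ∈ ℝ^{(d+2)×n_p×1} with entries (1,:,1) = Lψ_p(x), (2,:,1) = ψ_p(x), (2+i,:,1) = ∇ψ_p(x)·σ_{:,i}(x). That is, LΨ(x)_{u_1,…,u_p} equals the sum over all interior rank indices of the product of the corresponding core entries. -/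
open Finset

/-- The Kolmogorov backward operator
`Lφ(x) = ½ Σ_{i,j} a_{ij}(x) ∂²φ/∂x^i∂x^j(x) + Σ_i b_i(x) ∂φ/∂x^i(x)` with
`a(x) = σ(x)σ(x)ᵀ`, i.e. `a_{ij}(x) = Σ_s σ_{is}(x) σ_{js}(x)`; partial
derivatives are expressed via (iterated) Fréchet derivatives applied to
canonical unit vectors. -/
noncomputable def Lgen (d : ℕ) (b : (Fin d → ℝ) → Fin d → ℝ)
    (σ : (Fin d → ℝ) → Fin d → Fin d → ℝ)
    (φ : (Fin d → ℝ) → ℝ) (x : Fin d → ℝ) : ℝ :=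
  (1 / 2) * (∑ i : Fin d, ∑ j : Fin d,
      (∑ s : Fin d, σ x i s * σ x j s) *
        fderiv ℝ (fun y => fderiv ℝ φ y (Pi.single j 1)) x (Pi.single i 1)) +
    ∑ i : Fin d, b x i * fderiv ℝ φ x (Pi.single i 1)

/-- The `v`-th component of `∇ψ_k(x) · σ_{:,i}(x)`, i.e.
`Σ_j ∂ψ_{k,v}/∂x^j(x) σ_{ji}(x)`. -/
noncomputable def gradSigma (p d : ℕ) (n : Fin p → ℕ)
    (σ : (Fin d → ℝ) → Fin d → Fin d → ℝ)
    (ψ : (k : Fin p) → (Fin d → ℝ) → Fin (n k) → ℝ)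
    (x : Fin d → ℝ) (k : Fin p) (i : Fin d) (v : Fin (n k)) : ℝ :=
  ∑ j : Fin d, fderiv ℝ (fun y => ψ k y v) x (Pi.single j 1) * σ x j i

/-- The TT core of rank `d + 2` from Corollary 3 (zero-based indices):
row `0` is `(ψ_k(x), Lψ_k(x), ∇ψ_k(x)·σ_{:,1}(x), …, ∇ψ_k(x)·σ_{:,d}(x))`,
column `1` is `(Lψ_k(x), ψ_k(x), ∇ψ_k(x)·σ_{:,1}(x), …, ∇ψ_k(x)·σ_{:,d}(x))`,
the diagonal entries `(2+i, 2+i)` are `ψ_k(x)`, and all other entries vanish.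
The first core of the tensor train is row `0` of this core, and the last
core is column `1`. -/
noncomputable def lCore (p d : ℕ) (n : Fin p → ℕ)
    (b : (Fin d → ℝ) → Fin d → ℝ)
    (σ : (Fin d → ℝ) → Fin d → Fin d → ℝ)
    (ψ : (k : Fin p) → (Fin d → ℝ) → Fin (n k) → ℝ)
    (x : Fin d → ℝ)
    (k : Fin p) (s : Fin (d + 2)) (u : Fin (n k)) (t : Fin (d + 2)) : ℝ :=
  if s.val = 0 then
    if t.val = 0 then ψ k x u
    else if t.val = 1 then Lgen d b σ (fun y => ψ k y u) x
    else if ht : t.val - 2 < d then gradSigma p d n σ ψ x k ⟨t.val - 2, ht⟩ u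
    else 0
  else if s.val = 1 then
    if t.val = 1 then ψ k x u else 0
  else
    if t.val = 1 then
      (if hs : s.val - 2 < d then gradSigma p d n σ ψ x k ⟨s.val - 2, hs⟩ u else 0)
    else if t = s then ψ k x u else 0

/-- Left rank index of core `k` (boundary `s₀ = 0`, i.e. first core = row `0`). -/
def lLeft (p d : ℕ) (s : Fin (p - 1) → Fin (d + 2)) (k : Fin p) : Fin (d + 2) :=
  if hk : k.val = 0 then ⟨0, by omega⟩
  else s ⟨k.val - 1, by have := k.isLt; omega⟩

/-- Right rank index of core `k` (boundary `s_p = 1`, i.e. last core = column `1`). -/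
def lRight (p d : ℕ) (s : Fin (p - 1) → Fin (d + 2)) (k : Fin p) : Fin (d + 2) :=
  if hk : k.val < p - 1 then s ⟨k.val, hk⟩ else ⟨1, by omega⟩


noncomputable def gSig (d : ℕ) (σ : (Fin d → ℝ) → Fin d → Fin d → ℝ)
    (f : (Fin d → ℝ) → ℝ) (x : Fin d → ℝ) (i : Fin d) : ℝ :=
  ∑ j : Fin d, fderiv ℝ f x (Pi.single j 1) * σ x j i

noncomputable def coreOf (d : ℕ) (b : (Fin d → ℝ) → Fin d → ℝ)
    (σ : (Fin d → ℝ) → Fin d → Fin d → ℝ)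
    (f : (Fin d → ℝ) → ℝ) (x : Fin d → ℝ) (s t : Fin (d + 2)) : ℝ :=
  if s.val = 0 then
    if t.val = 0 then f x
    else if t.val = 1 then Lgen d b σ f x
    else if ht : t.val - 2 < d then gSig d σ f x ⟨t.val - 2, ht⟩
    else 0
  else if s.val = 1 then
    if t.val = 1 then f x else 0
  else
    if t.val = 1 then
      (if hs : s.val - 2 < d then gSig d σ f x ⟨s.val - 2, hs⟩ else 0)
    else if t = s then f x else 0

theorem fderiv_mul_apply' {d : ℕ} {f g : (Fin d → ℝ) → ℝ} (hf : ContDiff ℝ 2 f)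
    (hg : ContDiff ℝ 2 g) (y v : Fin d → ℝ) :
    fderiv ℝ (fun y => f y * g y) y v = f y * fderiv ℝ g y v + fderiv ℝ f y v * g y := by
  rw [fderiv_fun_mul (hf.differentiable (by norm_num) y) (hg.differentiable (by norm_num) y)]
  simp [mul_comm]

theorem diff_fderiv_apply {d : ℕ} {f : (Fin d → ℝ) → ℝ} (hf : ContDiff ℝ 2 f)
    (v : Fin d → ℝ) : Differentiable ℝ (fun y => fderiv ℝ f y v) := by
  have h : ContDiff ℝ 1 (fderiv ℝ f) := hf.fderiv_right (by norm_num)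
  exact (h.differentiable (by norm_num)).clm_apply (differentiable_const v)

theorem fderiv2_mul_apply {d : ℕ} {f g : (Fin d → ℝ) → ℝ} (hf : ContDiff ℝ 2 f)
    (hg : ContDiff ℝ 2 g) (x v w : Fin d → ℝ) :
    fderiv ℝ (fun y => fderiv ℝ (fun y => f y * g y) y v) x w =
      f x * fderiv ℝ (fun y => fderiv ℝ g y v) x w + fderiv ℝ f x w * fderiv ℝ g x v
      + fderiv ℝ f x v * fderiv ℝ g x w + fderiv ℝ (fun y => fderiv ℝ f y v) x w * g x := by
  have e : (fun y => fderiv ℝ (fun y => f y * g y) y v) =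
      fun y => f y * fderiv ℝ g y v + fderiv ℝ f y v * g y :=
    funext fun y => fderiv_mul_apply' hf hg y v
  have df := hf.differentiable (by norm_num) x
  have dg := hg.differentiable (by norm_num) x
  have df' := diff_fderiv_apply hf v x
  have dg' := diff_fderiv_apply hg v x
  rw [e, fderiv_fun_add (df.fun_mul dg') (df'.fun_mul dg), fderiv_fun_mul df dg', fderiv_fun_mul df' dg]
  simp
  ring

theorem gSig_mul {d : ℕ} (σ : (Fin d → ℝ) → Fin d → Fin d → ℝ)
    {f g : (Fin d → ℝ) → ℝ} (hf : ContDiff ℝ 2 f)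
    (hg : ContDiff ℝ 2 g) (x : Fin d → ℝ) (i : Fin d) :
    gSig d σ (fun y => f y * g y) x i = f x * gSig d σ g x i + gSig d σ f x i * g x := by
  simp only [gSig, fderiv_mul_apply' hf hg, mul_sum, sum_mul, ← sum_add_distrib]
  exact sum_congr rfl fun j _ => by ring

theorem cross_sum {d : ℕ} (S : Fin d → Fin d → ℝ) (F G : Fin d → ℝ) :
    ∑ i, ∑ j, (∑ s, S i s * S j s) * (F i * G j)
      = ∑ s, (∑ j, F j * S j s) * (∑ j, G j * S j s) := by
  simp only [sum_mul_sum]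
  rw [sum_comm (s := univ (α := Fin d)) (t := univ) (f := fun s i => ∑ j, _)]
  refine sum_congr rfl fun i _ => ?_
  rw [sum_comm]
  refine sum_congr rfl fun j _ => ?_
  rw [sum_mul]
  exact sum_congr rfl fun s _ => by ring

theorem Lgen_mul {d : ℕ} (b : (Fin d → ℝ) → Fin d → ℝ)
    (σ : (Fin d → ℝ) → Fin d → Fin d → ℝ)
    {f g : (Fin d → ℝ) → ℝ} (hf : ContDiff ℝ 2 f)
    (hg : ContDiff ℝ 2 g) (x : Fin d → ℝ) :
    Lgen d b σ (fun y => f y * g y) x = f x * Lgen d b σ g x + Lgen d b σ f x * g x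
      + ∑ i, gSig d σ f x i * gSig d σ g x i := by
  have c1 := cross_sum (σ x) (fun i => fderiv ℝ f x (Pi.single i 1))
    (fun i => fderiv ℝ g x (Pi.single i 1))
  have c2 := cross_sum (σ x) (fun i => fderiv ℝ g x (Pi.single i 1))
    (fun i => fderiv ℝ f x (Pi.single i 1))
  have c3 : ∑ i, gSig d σ f x i * gSig d σ g x i = ∑ i, gSig d σ g x i * gSig d σ f x i :=
    sum_congr rfl fun i _ => mul_comm _ _
  change _ = ∑ i, gSig d σ f x i * gSig d σ g x i at c1
  change _ = ∑ i, gSig d σ g x i * gSig d σ f x i at c2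
  have h : ∑ i, gSig d σ f x i * gSig d σ g x i =
      (1 / 2) * (∑ i, gSig d σ f x i * gSig d σ g x i + ∑ i, gSig d σ g x i * gSig d σ f x i) := by
    rw [← c3]; ring
  rw [h, ← c1, ← c2]
  simp only [Lgen, fderiv2_mul_apply hf hg]
  simp only [fderiv_mul_apply' hf hg, mul_add, sum_add_distrib,
    add_mul]
  simp only [mul_sum, sum_mul]
  have r : ∀ A A' B B' C C' D D' E E' F F' : ℝ, A = A' → B = B' → C = C' → D = D' → E = E' →
      F = F' → A + B + C + D + (E + F) = A' + E' + (D' + F') + (B' + C') := by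
    intros; subst_vars; ring
  apply r <;> (repeat' refine sum_congr rfl fun _ _ => ?_) <;> ring

/-- Left index with a free boundary value. -/
def gLeft {ι : Type} {q : ℕ} (a : ι) (s : Fin q → ι) : Fin (q + 1) → ι := Fin.cons a s

def gRight {ι : Type} {q : ℕ} (c : ι) (s : Fin q → ι) : Fin (q + 1) → ι := Fin.snoc s c

theorem tt_step {ι : Type} [Fintype ι] {q : ℕ} (M : Fin (q + 2) → ι → ι → ℝ) (a c : ι) :
    ∑ s : Fin (q + 1) → ι, ∏ k, M k (gLeft a s k) (gRight c s k) =
      ∑ t, M 0 a t * ∑ s : Fin q → ι, ∏ k, M (Fin.succ k) (gLeft t s k) (gRight c s k) := by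
  rw [← (Fin.consEquiv (fun _ : Fin (q + 1) => ι)).sum_comp, Fintype.sum_prod_type]
  refine sum_congr rfl fun t _ => ?_
  rw [mul_sum]
  refine sum_congr rfl fun s _ => ?_
  rw [Fin.prod_univ_succ]
  have e : gRight c (Fin.cons t s : Fin (q + 1) → ι) = Fin.cons t (gRight c s) := by
    unfold gRight
    exact (Fin.cons_snoc_eq_snoc_cons t s c).symm
  simp only [Fin.consEquiv, Equiv.coe_fn_mk, e]
  simp [gLeft]

theorem tt_main {d : ℕ} (b : (Fin d → ℝ) → Fin d → ℝ)
    (σ : (Fin d → ℝ) → Fin d → Fin d → ℝ) (x : Fin d → ℝ) (q : ℕ) :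
    ∀ (f : Fin (q + 1) → (Fin d → ℝ) → ℝ) (_ : ∀ k, ContDiff ℝ 2 (f k)) (a : Fin (d + 2)),
      ∑ s : Fin q → Fin (d + 2), ∏ k, coreOf d b σ (f k) x (gLeft a s k) (gRight 1 s k) =
        coreOf d b σ (fun y => ∏ k, f k y) x a 1 := by
  induction q with
  | zero =>
    intro f _ a
    simp [gLeft, gRight, Fin.snoc]
  | succ q ih =>
    intro f hf a
    have hg : ContDiff ℝ 2 (fun y => ∏ k : Fin (q + 1), f k.succ y) :=
      contDiff_prod fun k _ => hf k.succ
    rw [tt_step (fun k => coreOf d b σ (f k) x)]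
    simp only [ih (fun k => f k.succ) (fun k => hf k.succ)]
    simp only [Fin.prod_univ_succ (n := q + 1)]
    obtain ⟨g, hgd⟩ : ∃ g : (Fin d → ℝ) → ℝ, g = fun y => ∏ k : Fin (q + 1), f k.succ y :=
      ⟨_, rfl⟩
    have hgy : ∀ y, ∏ k : Fin (q + 1), f k.succ y = g y := fun y => by rw [hgd]
    simp only [hgy] at hg ⊢
    rw [Fin.sum_univ_succ, Fin.sum_univ_succ]
    refine Fin.cases ?_ (fun a => Fin.cases ?_ (fun i => ?_) a) a
    · simp [coreOf, Lgen_mul b σ (hf 0) hg]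
      ring
    · simp [coreOf]
    · simp [coreOf, gSig_mul σ (hf 0) hg, Fin.ext_iff]
      simp [← Fin.ext_iff]
      ring

/-- **Corollary 3**: the generator data tensor
`LΨ(x)_{u₁,…,u_p} = L(ψ_{1,u₁} ⋯ ψ_{p,u_p})(x)` admits a tensor train
representation with all interior ranks equal to `d + 2` and cores given by
`lCore` (first core = row `0`, last core = column `1`). -/
theorem generator_data_tensor_tt_representation (p d : ℕ) (hp : 2 ≤ p) (hd : 1 ≤ d)
    (n : Fin p → ℕ) (hn : ∀ k, 1 ≤ n k)
    (b : (Fin d → ℝ) → Fin d → ℝ)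
    (σ : (Fin d → ℝ) → Fin d → Fin d → ℝ)
    (ψ : (k : Fin p) → (Fin d → ℝ) → Fin (n k) → ℝ)
    (hsmooth : ∀ (k : Fin p) (v : Fin (n k)), ContDiff ℝ 2 (fun y => ψ k y v))
    (x : Fin d → ℝ)
    (u : (k : Fin p) → Fin (n k)) :
    Lgen d b σ (fun y => ∏ k : Fin p, ψ k y (u k)) x =
      ∑ s : Fin (p - 1) → Fin (d + 2),
        ∏ k : Fin p,
          lCore p d n b σ ψ x k (lLeft p d s k) (u k) (lRight p d s k) := by
  obtain ⟨q, rfl⟩ : ∃ q, p = q + 1 := ⟨p - 1, by omega⟩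
  have h := tt_main b σ x q (fun k y => ψ k y (u k)) (fun k => hsmooth k (u k)) 0
  have h0 : coreOf d b σ (fun y => ∏ k, ψ k y (u k)) x 0 1
      = Lgen d b σ (fun y => ∏ k, ψ k y (u k)) x := by
    simp [coreOf]
  rw [h0] at h
  rw [← h]
  refine sum_congr rfl fun s _ => prod_congr rfl fun k _ => ?_
  have hl : gLeft 0 s k = lLeft (q + 1) d s k := by
    refine Fin.cases ?_ (fun j => ?_) k
    · simp [gLeft, lLeft]
    · simp [gLeft, lLeft]
  have hr : gRight 1 s k = lRight (q + 1) d s k := by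
    refine Fin.lastCases ?_ (fun j => ?_) k
    · simp [gRight, lRight]
    · simp [gRight, lRight]
  rw [hl, hr]
  rfl
end
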